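/- Let U_1,…,U_N be i.i.d. ~ P_U, let K_1,…,K_n be i.i.d., let (Y^n, Z^n) be jointly distributed with (U^N, K^n), and let Û^N = g_n(Z^n, K^n) for some function g_n, satisfying (1/N) Σ_{i=1}^N E d'(U_i, Û_i) ≤ D'. If H(U^N|Y^n, Z^n) ≥ Nh, then Σ_{t=1}^n H(K_t|Y_t) ≥ N·[h − H(U) + R_U(D')], where R_U is the rate-distortion function of P_U with respect to d'. In particular, in the limit this yields h ≤ H(K|Y)/λ + H(U) − R_U(D') with N = λn. -/

import Mathlib

open Finset

noncomputable section

namespace JWE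

variable {Ω α β γ : Type*}

/-- Probability that the random variable `f` takes the value `a`, under the pmf `μ`. -/
def prEq [Fintype Ω] [DecidableEq α] (μ : Ω → ℝ) (f : Ω → α) (a : α) : ℝ :=
  ∑ ω, if f ω = a then μ ω else 0

/-- `μ` is a probability mass function on the finite type `Ω`. -/
def IsPMF [Fintype Ω] (μ : Ω → ℝ) : Prop :=
  (∀ ω, 0 ≤ μ ω) ∧ ∑ ω, μ ω = 1

/-- Shannon entropy (in bits) of the random variable `f` under `μ`. -/
def ent [Fintype Ω] [Fintype α] [DecidableEq α] (μ : Ω → ℝ) (f : Ω → α) : ℝ :=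
  -∑ a, prEq μ f a * Real.logb 2 (prEq μ f a)

/-- Shannon entropy (in bits) of a pmf `p` on a finite alphabet. -/
def entPMF [Fintype α] (p : α → ℝ) : ℝ :=
  -∑ a, p a * Real.logb 2 (p a)

/-- Conditional entropy H(f | g) under `μ`. -/
def condEnt [Fintype Ω] [Fintype α] [DecidableEq α] [Fintype β] [DecidableEq β]
    (μ : Ω → ℝ) (f : Ω → α) (g : Ω → β) : ℝ :=
  ent μ (fun ω => (f ω, g ω)) - ent μ g

/-- Mutual information I(f ; g) under `μ`. -/
def mutInf [Fintype Ω] [Fintype α] [DecidableEq α] [Fintype β] [DecidableEq β]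
    (μ : Ω → ℝ) (f : Ω → α) (g : Ω → β) : ℝ :=
  ent μ f + ent μ g - ent μ (fun ω => (f ω, g ω))

/-- Conditional mutual information I(f ; g | h) under `μ`. -/
def condMutInf [Fintype Ω] [Fintype α] [DecidableEq α] [Fintype β] [DecidableEq β]
    [Fintype γ] [DecidableEq γ] (μ : Ω → ℝ) (f : Ω → α) (g : Ω → β) (h : Ω → γ) : ℝ :=
  condEnt μ f h - condEnt μ f (fun ω => (g ω, h ω))

/-- Expected distortion E d(f, g) under `μ`. -/
def expDist [Fintype Ω] (μ : Ω → ℝ) (d : α → β → ℝ) (f : Ω → α) (g : Ω → β) : ℝ :=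
  ∑ ω, μ ω * d (f ω) (g ω)

/-- `W` is a channel (conditional pmf) from `α` to `β`. -/
def IsChannel [Fintype β] (W : α → β → ℝ) : Prop :=
  (∀ a b, 0 ≤ W a b) ∧ ∀ a, ∑ b, W a b = 1

/-- `f` and `g` are independent under `μ`. -/
def IndepRV [Fintype Ω] [DecidableEq α] [DecidableEq β]
    (μ : Ω → ℝ) (f : Ω → α) (g : Ω → β) : Prop :=
  ∀ a b, prEq μ (fun ω => (f ω, g ω)) (a, b) = prEq μ f a * prEq μ g b

/-- `f` and `g` are conditionally independent given `h` under `μ`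
(equivalently, `f → h → g` is a Markov chain). -/
def CondIndep [Fintype Ω] [DecidableEq α] [DecidableEq β] [DecidableEq γ]
    (μ : Ω → ℝ) (f : Ω → α) (g : Ω → β) (h : Ω → γ) : Prop :=
  ∀ a b c, prEq μ (fun ω => ((f ω, g ω), h ω)) ((a, b), c) * prEq μ h c =
    prEq μ (fun ω => (f ω, h ω)) (a, c) * prEq μ (fun ω => (g ω, h ω)) (b, c)

/-- The coordinates of the random vector `f` are i.i.d. with single-letter law `q`. -/
def IIDWithLaw [Fintype Ω] [DecidableEq α] {n : ℕ}
    (μ : Ω → ℝ) (f : Ω → Fin n → α) (q : α → ℝ) : Prop :=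
  ∀ v : Fin n → α, prEq μ f v = ∏ t, q (v t)

/-- Rate–distortion function of the source `pU` with respect to the distortion measure `d'`. -/
def RU {U Uh : Type*} [Fintype U] [DecidableEq U] [Fintype Uh] [DecidableEq Uh]
    (pU : U → ℝ) (d' : U → Uh → ℝ) (D' : ℝ) : ℝ :=
  sInf { r : ℝ | ∃ W : U → Uh → ℝ, IsChannel W ∧
    (∑ u, ∑ uh, pU u * W u uh * d' u uh) ≤ D' ∧
    r = mutInf (fun p : U × Uh => pU p.1 * W p.1 p.2) Prod.fst Prod.snd }

end JWE

namespace JWE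

section Entropy

variable {Ω α β γ : Type*} [Fintype Ω] [DecidableEq α] [DecidableEq β] [DecidableEq γ]

/-- Conditional probability of `f = a` given `g = b` under `μ`. -/
def condPr (μ : Ω → ℝ) (f : Ω → α) (g : Ω → β) (a : α) (b : β) : ℝ :=
  prEq μ (fun ω => (f ω, g ω)) (a, b) / prEq μ g b

lemma prEq_nonneg {μ : Ω → ℝ} (hμ : ∀ ω, 0 ≤ μ ω) (f : Ω → α) (a : α) : 0 ≤ prEq μ f a :=
  Finset.sum_nonneg fun ω _ => by split_ifs <;> simp [hμ]

lemma le_prEq {μ : Ω → ℝ} (hμ : ∀ ω, 0 ≤ μ ω) (f : Ω → α) (ω : Ω) : μ ω ≤ prEq μ f (f ω) := by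
  have := Finset.single_le_sum (f := fun ω' => if f ω' = f ω then μ ω' else 0)
    (fun ω' _ => by split_ifs <;> simp [hμ]) (Finset.mem_univ ω)
  simpa [prEq] using this

lemma prEq_pos {μ : Ω → ℝ} (hμ : ∀ ω, 0 ≤ μ ω) (f : Ω → α) {ω : Ω} (hω : μ ω ≠ 0) :
    0 < prEq μ f (f ω) :=
  ((hμ ω).lt_of_ne' hω).trans_le (le_prEq hμ f ω)

lemma condPr_nonneg {μ : Ω → ℝ} (hμ : ∀ ω, 0 ≤ μ ω) (f : Ω → α) (g : Ω → β) (a : α) (b : β) :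
    0 ≤ condPr μ f g a b :=
  div_nonneg (prEq_nonneg hμ _ _) (prEq_nonneg hμ _ _)

lemma condPr_pos {μ : Ω → ℝ} (hμ : ∀ ω, 0 ≤ μ ω) (f : Ω → α) (g : Ω → β) {ω : Ω} (hω : μ ω ≠ 0) :
    0 < condPr μ f g (f ω) (g ω) :=
  div_pos (prEq_pos hμ (fun ω => (f ω, g ω)) hω) (prEq_pos hμ g hω)

lemma sum_prEq_mul [Fintype α] (μ : Ω → ℝ) (f : Ω → α) (F : α → ℝ) :
    ∑ a, prEq μ f a * F a = ∑ ω, μ ω * F (f ω) := by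
  simp only [prEq, Finset.sum_mul]
  rw [Finset.sum_comm]
  simp [ite_mul]

lemma sum_prEq [Fintype α] (μ : Ω → ℝ) (f : Ω → α) : ∑ a, prEq μ f a = ∑ ω, μ ω := by
  simpa using sum_prEq_mul μ f fun _ => 1

lemma prEq_prEq [Fintype α] (μ : Ω → ℝ) (X : Ω → α) (f : α → β) (b : β) :
    prEq (prEq μ X) f b = prEq μ (fun ω => f (X ω)) b := by
  simpa [prEq] using sum_prEq_mul μ X fun a => if f a = b then 1 else 0

lemma sum_prEq_pair [Fintype α] (μ : Ω → ℝ) (f : Ω → α) (g : Ω → β) (b : β) :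
    ∑ a, prEq μ (fun ω => (f ω, g ω)) (a, b) = prEq μ g b := by
  simp only [prEq, Prod.mk.injEq, ite_and]
  rw [Finset.sum_comm]
  simp

lemma sum_prEq_pair_right [Fintype β] (μ : Ω → ℝ) (f : Ω → α) (g : Ω → β) (a : α) :
    ∑ b, prEq μ (fun ω => (f ω, g ω)) (a, b) = prEq μ f a := by
  simp only [prEq, Prod.mk.injEq, and_comm (a := f _ = a), ite_and]
  rw [Finset.sum_comm]
  simp

lemma sum_condPr_le_one [Fintype α] (μ : Ω → ℝ) (f : Ω → α) (g : Ω → β) (b : β) :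
    ∑ a, condPr μ f g a b ≤ 1 := by
  simp only [condPr]
  rw [← Finset.sum_div, sum_prEq_pair]
  exact div_self_le_one _

variable [Fintype α] [Fintype β] [Fintype γ]

lemma ent_eq (μ : Ω → ℝ) (f : Ω → α) :
    ent μ f = -∑ ω, μ ω * Real.logb 2 (prEq μ f (f ω)) := by
  rw [ent, sum_prEq_mul μ f fun a => Real.logb 2 (prEq μ f a)]

lemma ent_prEq (μ : Ω → ℝ) (X : Ω → α) (f : α → β) :
    ent (prEq μ X) f = ent μ (fun ω => f (X ω)) := by
  simp only [ent, prEq_prEq]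

lemma ent_comp_le {μ : Ω → ℝ} (hμ : ∀ ω, 0 ≤ μ ω) (f : Ω → α) (φ : α → β) :
    ent μ (fun ω => φ (f ω)) ≤ ent μ f := by
  rw [ent_eq, ent_eq, neg_le_neg_iff]
  refine Finset.sum_le_sum fun ω _ => ?_
  by_cases hω : μ ω = 0
  · simp [hω]
  refine mul_le_mul_of_nonneg_left ?_ (hμ ω)
  refine Real.logb_le_logb_of_le (by norm_num) (prEq_pos hμ f hω) ?_
  refine Finset.sum_le_sum fun ω' _ => ?_
  by_cases h : f ω' = f ω
  · simp [h]
  · simp only [h, if_false]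
    split_ifs <;> simp [hμ]

lemma condEnt_eq {μ : Ω → ℝ} (hμ : ∀ ω, 0 ≤ μ ω) (f : Ω → α) (g : Ω → β) :
    condEnt μ f g = -∑ ω, μ ω * Real.logb 2 (condPr μ f g (f ω) (g ω)) := by
  rw [condEnt, ent_eq, ent_eq, neg_sub_neg, ← Finset.sum_sub_distrib, ← Finset.sum_neg_distrib]
  refine Finset.sum_congr rfl fun ω _ => ?_
  by_cases hω : μ ω = 0
  · simp [hω]
  rw [condPr, Real.logb_div (prEq_pos hμ (fun ω => (f ω, g ω)) hω).ne' (prEq_pos hμ g hω).ne']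
  ring

/-- The Gibbs inequality for conditional entropy: the cross entropy with respect to any conditional
subprobability `q` is at least the conditional entropy. -/
lemma condEnt_le_cross {μ : Ω → ℝ} (hμ : ∀ ω, 0 ≤ μ ω) (f : Ω → α) (g : Ω → β) (q : α → β → ℝ)
    (hq : ∀ a b, 0 ≤ q a b) (hq_sum : ∀ b, ∑ a, q a b ≤ 1)
    (hq_pos : ∀ ω, μ ω ≠ 0 → 0 < q (f ω) (g ω)) :
    condEnt μ f g ≤ -∑ ω, μ ω * Real.logb 2 (q (f ω) (g ω)) := by
  rw [condEnt_eq hμ, neg_le_neg_iff, ← sub_nonpos, ← Finset.sum_sub_distrib]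
  have hlog2 : 0 < Real.log 2 := Real.log_pos (by norm_num)
  have hterm : ∀ ω, μ ω * Real.logb 2 (q (f ω) (g ω)) -
      μ ω * Real.logb 2 (condPr μ f g (f ω) (g ω)) ≤
      (μ ω * (q (f ω) (g ω) / condPr μ f g (f ω) (g ω)) - μ ω) / Real.log 2 := by
    intro ω
    by_cases hω : μ ω = 0
    · simp [hω]
    have h1 := hq_pos ω hω
    have h2 := condPr_pos hμ f g hω
    rw [← mul_sub, ← Real.logb_div h1.ne' h2.ne', Real.logb, ← mul_div_assoc]
    gcongr
    have := mul_le_mul_of_nonneg_left (Real.log_le_sub_one_of_pos (div_pos h1 h2)) (hμ ω)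
    linarith
  refine (Finset.sum_le_sum fun ω _ => hterm ω).trans ?_
  rw [← Finset.sum_div, Finset.sum_sub_distrib]
  refine div_nonpos_of_nonpos_of_nonneg (sub_nonpos.2 ?_) hlog2.le
  rw [← sum_prEq_mul μ (fun ω => (f ω, g ω)) fun p => q p.1 p.2 / condPr μ f g p.1 p.2,
    Fintype.sum_prod_type_right, ← sum_prEq μ g]
  refine Finset.sum_le_sum fun b _ => ?_
  calc ∑ a, prEq μ (fun ω => (f ω, g ω)) (a, b) * (q a b / condPr μ f g a b)
      ≤ ∑ a, prEq μ g b * q a b := by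
        refine Finset.sum_le_sum fun a _ => ?_
        by_cases h : prEq μ (fun ω => (f ω, g ω)) (a, b) = 0
        · simpa [h] using mul_nonneg (prEq_nonneg hμ g b) (hq a b)
        · simp only [condPr]
          refine le_of_eq ?_
          field_simp
    _ = prEq μ g b * ∑ a, q a b := (Finset.mul_sum _ _ _).symm
    _ ≤ prEq μ g b := mul_le_of_le_one_right (prEq_nonneg hμ g b) (hq_sum b)

/-- Conditioning on a function of `g` instead of `g` increases the conditional entropy. -/
lemma condEnt_le_condEnt_comp {μ : Ω → ℝ} (hμ : ∀ ω, 0 ≤ μ ω) (f : Ω → α) (g : Ω → β) (φ : β → γ) :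
    condEnt μ f g ≤ condEnt μ f (fun ω => φ (g ω)) := by
  rw [condEnt_eq hμ f fun ω => φ (g ω)]
  exact condEnt_le_cross hμ f g (fun a b => condPr μ f (fun ω => φ (g ω)) a (φ b))
    (fun a b => condPr_nonneg hμ _ _ _ _) (fun b => sum_condPr_le_one _ _ _ _)
    fun ω hω => condPr_pos hμ f (fun ω => φ (g ω)) hω

lemma mutInf_nonneg {μ : Ω → ℝ} (hμ : IsPMF μ) (f : Ω → α) (g : Ω → β) : 0 ≤ mutInf μ f g := by
  have h : condEnt μ f g ≤ ent μ f := by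
    rw [ent_eq]
    exact condEnt_le_cross hμ.1 f g (fun a _ => prEq μ f a) (fun a _ => prEq_nonneg hμ.1 f a)
      (fun _ => (sum_prEq μ f).trans hμ.2 |>.le) fun ω hω => prEq_pos hμ.1 f hω
  rw [condEnt] at h
  rw [mutInf]
  linarith

/-- Conditional entropy of a vector is at most the sum of the letterwise conditional entropies. -/
lemma condEnt_pi_le_sum {μ : Ω → ℝ} (hμ : ∀ ω, 0 ≤ μ ω) {n : ℕ} (f : Ω → Fin n → α)
    (g : Ω → Fin n → β) :
    condEnt μ f g ≤ ∑ t, condEnt μ (fun ω => f ω t) (fun ω => g ω t) := by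
  refine (condEnt_le_cross hμ f g
    (fun a b => ∏ t, condPr μ (fun ω => f ω t) (fun ω => g ω t) (a t) (b t))
    (fun a b => Finset.prod_nonneg fun t _ => condPr_nonneg hμ _ _ _ _) (fun b => ?_)
    fun ω hω => Finset.prod_pos fun t _ =>
      condPr_pos hμ (fun ω => f ω t) (fun ω => g ω t) hω).trans_eq ?_
  · rw [← Fintype.prod_sum fun t a => condPr μ (fun ω => f ω t) (fun ω => g ω t) a (b t)]
    exact Finset.prod_le_one
      (fun t _ => Finset.sum_nonneg fun a _ => condPr_nonneg hμ _ _ _ _)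
      fun t _ => sum_condPr_le_one _ _ _ _
  · simp only [fun t => condEnt_eq hμ (fun ω => f ω t) (fun ω => g ω t)]
    rw [Finset.sum_neg_distrib, Finset.sum_comm]
    congr 1
    refine Finset.sum_congr rfl fun ω _ => ?_
    by_cases hω : μ ω = 0
    · simp [hω]
    rw [← Finset.mul_sum, Real.logb_prod]
    exact fun t _ => (condPr_pos hμ (fun ω => f ω t) (fun ω => g ω t) hω).ne'

/-- Equivocation bound: if `X` is determined by `g` and `k`, then `H(f | g) ≤ H(k | g) + H(f | X)`. -/
lemma condEnt_le_add {δ ε : Type*} [Fintype δ] [DecidableEq δ] [Fintype ε] [DecidableEq ε]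
    {μ : Ω → ℝ} (hμ : ∀ ω, 0 ≤ μ ω) (f : Ω → α) (k : Ω → γ) (g : Ω → δ) (ψ : γ × δ → ε) :
    condEnt μ f g ≤ condEnt μ k g + condEnt μ f (fun ω => ψ (k ω, g ω)) := by
  have h1 := condEnt_le_condEnt_comp hμ f (fun ω => (k ω, g ω)) ψ
  have h2 := ent_comp_le hμ (fun ω => (f ω, (k ω, g ω))) fun p => (p.1, p.2.2)
  simp only [condEnt] at h1 h2 ⊢
  linarith

lemma prEq_apply_of_iidWithLaw {n : ℕ} {μ : Ω → ℝ} {f : Ω → Fin n → α} {q : α → ℝ} (hq : IsPMF q)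
    (hf : IIDWithLaw μ f q) (i : Fin n) (a : α) : prEq μ (fun ω => f ω i) a = q a := by
  rw [← prEq_prEq μ f (fun v => v i)]
  simp only [prEq.eq_1 (prEq μ f), hf _]
  have h : ∀ v : Fin n → α, (if v i = a then ∏ t, q (v t) else 0) =
      ∏ t, if t = i then (if v t = a then q (v t) else 0) else q (v t) := by
    intro v
    split_ifs with hv
    · refine Finset.prod_congr rfl fun t _ => ?_
      by_cases ht : t = i
      · subst ht; simp [hv]
      · simp [ht]
    · exact (Finset.prod_eq_zero (Finset.mem_univ i) (by simp [hv])).symm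
  simp only [h]
  rw [← Fintype.prod_sum fun t b => if t = i then (if b = a then q b else 0) else q b,
    Finset.prod_eq_single i]
  · simp
  · intro t _ ht
    simp [ht, hq.2]
  · simp

end Entropy

section RateDistortion

variable {Ω α β : Type*} [Fintype Ω]
  [Fintype α] [DecidableEq α] [Fintype β] [DecidableEq β]

/-- The rate–distortion function bounds the mutual information of any pair of random variables
meeting the distortion constraint. -/
lemma RU_le_mutInf {μ : Ω → ℝ} (hμ : IsPMF μ) {p : α → ℝ} (hp : IsPMF p) (d : α → β → ℝ) {D : ℝ}
    (f : Ω → α) (g : Ω → β) (hf : ∀ a, prEq μ f a = p a) (hD : expDist μ d f g ≤ D) :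
    RU p d D ≤ mutInf μ f g := by
  have hΩ : Nonempty Ω := by
    by_contra h
    rw [not_nonempty_iff] at h
    simpa using hμ.2
  obtain ⟨b₀⟩ : Nonempty β := hΩ.map g
  set J : α × β → ℝ := prEq μ (fun ω => (f ω, g ω)) with hJ
  have hJ_nonneg : ∀ x, 0 ≤ J x := prEq_nonneg hμ.1 _
  have hJ_sum : ∀ a, ∑ b, J (a, b) = p a := fun a => (sum_prEq_pair_right μ f g a).trans (hf a)
  let W : α → β → ℝ := fun a b =>
    if p a = 0 then (if b = b₀ then 1 else 0) else J (a, b) / p a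
  have hW : IsChannel W := by
    refine ⟨fun a b => ?_, fun a => ?_⟩
    · by_cases ha : p a = 0
      · simp only [W, ha, if_true]
        split_ifs <;> norm_num
      · simpa [W, ha] using div_nonneg (hJ_nonneg _) (hp.1 a)
    · by_cases ha : p a = 0
      · simp [W, ha]
      · simp only [W, ha, if_false]
        rw [← Finset.sum_div, hJ_sum, div_self ha]
  have hpW : ∀ a b, p a * W a b = J (a, b) := by
    intro a b
    by_cases ha : p a = 0
    · have h := hJ_sum a
      rw [ha, Finset.sum_eq_zero_iff_of_nonneg fun _ _ => hJ_nonneg _] at h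
      simp [ha, h b (Finset.mem_univ b)]
    · simp only [W, ha, if_false]
      field_simp
  have hbdd : BddBelow { r : ℝ | ∃ W : α → β → ℝ, IsChannel W ∧
      (∑ u, ∑ uh, p u * W u uh * d u uh) ≤ D ∧
      r = mutInf (fun x : α × β => p x.1 * W x.1 x.2) Prod.fst Prod.snd } := by
    refine ⟨0, ?_⟩
    rintro r ⟨V, hV, -, rfl⟩
    refine mutInf_nonneg ⟨fun x => mul_nonneg (hp.1 _) (hV.1 _ _), ?_⟩ _ _
    simp [Fintype.sum_prod_type, ← Finset.mul_sum, hV.2, hp.2]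
  refine csInf_le hbdd ⟨W, hW, ?_, ?_⟩
  · simp only [hpW]
    rw [← Fintype.sum_prod_type' fun a b => J (a, b) * d a b]
    exact (sum_prEq_mul μ (fun ω => (f ω, g ω)) fun x => d x.1 x.2).trans_le hD
  · have : (fun x : α × β => p x.1 * W x.1 x.2) = J := funext fun x => hpW x.1 x.2
    rw [this, mutInf, mutInf, hJ, ent_prEq, ent_prEq, ent_prEq]

/-- Single-letterization with a time-sharing variable: letterwise equivocations of an identically
distributed source, given a reproduction of average distortion at most `D`. -/
lemma sum_condEnt_le {N : ℕ} (hN : 0 < N) {μ : Ω → ℝ} (hμ : IsPMF μ) {p : α → ℝ} (hp : IsPMF p)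
    (d : α → β → ℝ) {D : ℝ} (f : Ω → Fin N → α) (g : Ω → Fin N → β)
    (hf : ∀ i a, prEq μ (fun ω => f ω i) a = p a)
    (hD : (1 / (N : ℝ)) * ∑ i, expDist μ d (fun ω => f ω i) (fun ω => g ω i) ≤ D) :
    ∑ i, condEnt μ (fun ω => f ω i) (fun ω => g ω i) ≤ N * (entPMF p - RU p d D) := by
  have hN' : (0 : ℝ) < N := Nat.cast_pos.2 hN
  let ν : Fin N × Ω → ℝ := fun x => 1 / N * μ x.2
  let F : Fin N × Ω → α := fun x => f x.2 x.1
  let G : Fin N × Ω → β := fun x => g x.2 x.1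
  have hν : IsPMF ν := by
    refine ⟨fun x => mul_nonneg (by positivity) (hμ.1 _), ?_⟩
    simp only [ν, Fintype.sum_prod_type, ← Finset.mul_sum, hμ.2]
    simp [hN'.ne']
  have hF : ∀ a, prEq ν F a = p a := by
    intro a
    have : ∀ i, ∑ ω, (if f ω i = a then 1 / (N : ℝ) * μ ω else 0) = 1 / N * p a := by
      intro i
      rw [← hf i a, prEq, Finset.mul_sum]
      simp only [mul_ite, mul_zero]
    simp only [prEq, ν, F, Fintype.sum_prod_type, this]
    simp [hN'.ne']
  have hD' : expDist ν d F G ≤ D := by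
    refine le_trans (le_of_eq ?_) hD
    simp only [expDist, ν, F, G, Fintype.sum_prod_type, Finset.mul_sum, mul_assoc]
  have hent : ent ν F = entPMF p := by simp only [ent, entPMF, hF]
  have hRU := RU_le_mutInf hν hp d F G hF hD'
  have hcond : condEnt ν F G ≤ entPMF p - RU p d D := by
    rw [mutInf, hent] at hRU
    rw [condEnt]
    linarith
  refine le_trans ?_ (mul_le_mul_of_nonneg_left hcond hN'.le)
  have hi : ∀ i, condEnt μ (fun ω => f ω i) (fun ω => g ω i) ≤
      -∑ ω, μ ω * Real.logb 2 (condPr ν F G (f ω i) (g ω i)) := fun i =>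
    condEnt_le_cross hμ.1 _ _ (condPr ν F G) (condPr_nonneg hν.1 F G)
      (sum_condPr_le_one ν F G) fun ω hω =>
        condPr_pos hν.1 F G (ω := (i, ω)) (mul_ne_zero (by positivity) hω)
  refine (Finset.sum_le_sum fun i _ => hi i).trans_eq ?_
  rw [condEnt_eq hν.1, Finset.sum_neg_distrib, mul_neg, Fintype.sum_prod_type, Finset.mul_sum]
  simp only [Finset.mul_sum, ν, F, G]
  congr 1
  refine Finset.sum_congr rfl fun i _ => Finset.sum_congr rfl fun ω _ => ?_
  field_simp

end RateDistortion

end JWE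

open JWE

/-- With U^N i.i.d. ~ P_U, K^n i.i.d., the Markov chain K^n → Y^n → Z^n,
a decoder Û^N = g_n(Z^n,K^n) with average distortion at most D', and equivocation
H(U^N|Y^n,Z^n) ≥ Nh, one has Σ_t H(K_t|Y_t) ≥ N·[h − H(U) + R_U(D')]. -/
theorem statement15 {Ω 𝒰 𝒰h 𝒦 𝒴 𝒵 : Type*} [Fintype Ω]
    [Fintype 𝒰] [DecidableEq 𝒰] [Fintype 𝒰h] [DecidableEq 𝒰h]
    [Fintype 𝒦] [DecidableEq 𝒦] [Fintype 𝒴] [DecidableEq 𝒴]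
    [Fintype 𝒵] [DecidableEq 𝒵]
    (n N : ℕ) (hN : 0 < N)
    (μ : Ω → ℝ) (hμ : IsPMF μ)
    (pU : 𝒰 → ℝ) (hpU : IsPMF pU) (pK : 𝒦 → ℝ) (hpK : IsPMF pK)
    (d' : 𝒰 → 𝒰h → ℝ) (hd' : ∀ u uh, 0 ≤ d' u uh)
    (D' h : ℝ)
    (U : Ω → Fin N → 𝒰) (K : Ω → Fin n → 𝒦) (Y : Ω → Fin n → 𝒴) (Z : Ω → Fin n → 𝒵)
    (hU : IIDWithLaw μ U pU) (hK : IIDWithLaw μ K pK)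
    (hMarkov : CondIndep μ K Z Y)
    (g : (Fin n → 𝒵) → (Fin n → 𝒦) → (Fin N → 𝒰h))
    (hdist : (1 / (N : ℝ)) * ∑ i : Fin N,
        expDist μ d' (fun ω => U ω i) (fun ω => g (Z ω) (K ω) i) ≤ D')
    (hequiv : condEnt μ U (fun ω => (Y ω, Z ω)) ≥ (N : ℝ) * h) :
    ∑ t : Fin n, condEnt μ (fun ω => K ω t) (fun ω => Y ω t) ≥
      (N : ℝ) * (h - entPMF pU + RU pU d' D') := by
  have hμ0 := hμ.1
  have h1 := condEnt_le_add hμ0 U K (fun ω => (Y ω, Z ω)) fun x => g x.2.2 x.1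
  have h2 := condEnt_le_condEnt_comp hμ0 K (fun ω => (Y ω, Z ω)) Prod.fst
  have h3 := condEnt_pi_le_sum hμ0 K Y
  have h4 := condEnt_pi_le_sum hμ0 U fun ω => g (Z ω) (K ω)
  have h5 := sum_condEnt_le hN hμ hpU d' U (fun ω => g (Z ω) (K ω))
    (prEq_apply_of_iidWithLaw hpU hU) hdist
  simp only at h1 h2
  linarith

end
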